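/- arXiv:1609.08204 — 3 statements merged into one kernel-verified Lean document; each statement's English description precedes it below -/
import Mathlib

section
/- Let β = p/q > 1 be rational with p, q coprime positive integers and β not an integer. If μ is a CIUPM for T_{0,β} with supp μ ⊆ [0, c_β] and diam(supp μ) = c_β, where c_β = 1 + (q−1)/p, then μ equals the measure with Lebesgue density ρ_β defined by ρ_β(t) = j/q for t ∈ [(j−1)/p, j/p) ∪ [1 + (q−j−1)/p, 1 + (q−j)/p) for j = 1, …, q−1, ρ_β(t) = 1 for t ∈ [(q−1)/p, 1), and ρ_β(t) = 0 elsewhere. -/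
open MeasureTheory Set

/-- The linear transformation `T_{α,β}(x) = βx + α`. -/
def T (α β : ℝ) : ℝ → ℝ := fun x => β * x + α

/-- A probability measure `μ` on `ℝ` is a CIUPM for a map `S : ℝ → ℝ` if the pushforwards
of `μ` and of `μ ∘ S⁻¹` under the fractional-part map both equal Lebesgue measure
restricted to `[0,1)`. -/
def IsCIUPM (S : ℝ → ℝ) (μ : Measure ℝ) : Prop :=
  μ.map Int.fract = volume.restrict (Ico (0 : ℝ) 1) ∧
    (μ.map S).map Int.fract = volume.restrict (Ico (0 : ℝ) 1)

/-- The topological support of a measure on `ℝ`: the set of points all of whose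
neighbourhoods have positive measure (the smallest closed set of full measure). -/
def msupp (μ : Measure ℝ) : Set ℝ := {x : ℝ | ∀ U ∈ nhds x, 0 < μ U}

/-- The density of `μ_β` for rational `β = p/q`: it equals `j/q` on
`[(j−1)/p, j/p) ∪ [1 + (q−j−1)/p, 1 + (q−j)/p)` for `j = 1, …, q−1`,
equals `1` on `[(q−1)/p, 1)`, and `0` elsewhere. -/
noncomputable def rhoQ (p q : ℕ) : ℝ → ℝ := fun t =>
  (∑ j ∈ Finset.Icc 1 (q - 1), ((j : ℝ) / q) *
      Set.indicator
        (Set.Ico (((j : ℝ) - 1) / p) ((j : ℝ) / p) ∪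
          Set.Ico (1 + ((q : ℝ) - (j : ℝ) - 1) / p) (1 + ((q : ℝ) - (j : ℝ)) / p)) 1 t)
    + Set.indicator (Set.Ico (((q : ℝ) - 1) / p) 1) 1 t

open Polynomial in
lemma isCoprime_geom_sum {m n : ℕ} (h : Nat.Coprime m n) :
    IsCoprime (∑ i ∈ Finset.range m, (X : ℝ[X]) ^ i) (∑ i ∈ Finset.range n, (X : ℝ[X]) ^ i) := by
  induction m, n using Nat.gcd.induction with
  | H0 n =>
    obtain rfl : n = 1 := by simpa using h
    simp [isCoprime_one_right]
  | H1 m n hm ih =>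
    have h' : Nat.Coprime (n % m) m := by
      rwa [Nat.Coprime, ← Nat.gcd_rec]
    have key : ∑ i ∈ Finset.range n, (X : ℝ[X]) ^ i =
        ∑ i ∈ Finset.range (n % m), (X : ℝ[X]) ^ i +
          (∑ i ∈ Finset.range m, (X : ℝ[X]) ^ i) *
            (X ^ (n % m) * ∑ k ∈ Finset.range (n / m), ((X : ℝ[X]) ^ m) ^ k) := by
      have hX : (X - 1 : ℝ[X]) ≠ 0 := X_sub_C_ne_zero 1
      apply mul_right_cancel₀ hX
      have e1 := geom_sum_mul (X : ℝ[X]) n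
      have e2 := geom_sum_mul (X : ℝ[X]) m
      have e3 := geom_sum_mul (X : ℝ[X]) (n % m)
      have e4 := geom_sum_mul ((X : ℝ[X]) ^ m) (n / m)
      have e5 : (X : ℝ[X]) ^ n = X ^ (n % m) * (X ^ m) ^ (n / m) := by
        rw [← pow_mul, ← pow_add, Nat.mod_add_div]
      rw [e1, add_mul, e3, e5]
      linear_combination (-(X : ℝ[X]) ^ (n % m)) * e4 - (X ^ (n % m) *
        ∑ k ∈ Finset.range (n / m), ((X : ℝ[X]) ^ m) ^ k) * e2
    rw [key]
    exact (ih h').symm.add_mul_left_right _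

open Polynomial in
lemma X_pow_sub_one_dvd_of_residue_sums {m N : ℕ} (hm : 0 < m) (a : ℕ → ℝ) (c : ℝ)
    (h : ∀ r < m, ∑ i ∈ Finset.range N with i % m = r, a i = c) :
    (X ^ m - 1 : ℝ[X]) ∣
      ∑ i ∈ Finset.range N, C (a i) * X ^ i - C c * ∑ r ∈ Finset.range m, X ^ r := by
  have e : C c * ∑ r ∈ Finset.range m, (X : ℝ[X]) ^ r =
      ∑ i ∈ Finset.range N, C (a i) * X ^ (i % m) := by
    rw [Finset.mul_sum, ← Finset.sum_fiberwise_of_maps_to (s := Finset.range N)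
      (t := Finset.range m) (g := fun i => i % m) (fun i _ => Finset.mem_range.2 (Nat.mod_lt i hm))]
    refine Finset.sum_congr rfl fun r hr => ?_
    rw [← h r (Finset.mem_range.1 hr), map_sum, Finset.sum_mul]
    refine Finset.sum_congr rfl fun i hi => ?_
    rw [(Finset.mem_filter.1 hi).2]
  rw [e, ← Finset.sum_sub_distrib]
  refine Finset.dvd_sum fun i _ => ?_
  have e5 : (X : ℝ[X]) ^ i = X ^ (i % m) * (X ^ m) ^ (i / m) := by
    rw [← pow_mul, ← pow_add, Nat.mod_add_div]
  have : C (a i) * X ^ i - C (a i) * X ^ (i % m) =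
      C (a i) * X ^ (i % m) * (((X : ℝ[X]) ^ m) ^ (i / m) - 1) := by rw [e5]; ring
  rw [this]
  exact Dvd.dvd.mul_left (sub_one_dvd_pow_sub_one _ _) _

open Polynomial in
lemma coeff_geom_sum_mul_geom_sum (p q n : ℕ) :
    ((∑ i ∈ Finset.range p, (X : ℝ[X]) ^ i) * ∑ i ∈ Finset.range q, (X : ℝ[X]) ^ i).coeff n =
      (min q (n + 1) - (n + 1 - p) : ℕ) := by
  rw [Finset.mul_sum, finsetSum_coeff]
  have : ∀ l, ((∑ i ∈ Finset.range p, (X : ℝ[X]) ^ i) * X ^ l).coeff n =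
      if l ≤ n ∧ n - l < p then 1 else 0 := by
    intro l
    rw [coeff_mul_X_pow']
    by_cases hl : l ≤ n <;> simp [hl, coeff_X_pow]
  simp_rw [this]
  rw [Finset.sum_boole, ← Nat.card_Ico]
  congr 2
  ext l
  simp only [Finset.mem_filter, Finset.mem_range, Finset.mem_Ico]
  omega

open Polynomial in
lemma eq_coeff_of_residue_sums {p q : ℕ} (hp : 0 < p) (hq : 0 < q) (hcop : Nat.Coprime p q)
    (a : ℕ → ℝ) (v : ℝ)
    (h₁ : ∀ r < p, ∑ i ∈ Finset.range (p + q - 1) with i % p = r, a i = v)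
    (h₂ : ∀ r < q, ∑ i ∈ Finset.range (p + q - 1) with i % q = r, a i = p / q * v)
    {n : ℕ} (hn : n < p + q - 1) :
    a n = (min q (n + 1) - (n + 1 - p) : ℕ) / q * v := by
  have d₁ := X_pow_sub_one_dvd_of_residue_sums hp a _ h₁
  have d₂ := X_pow_sub_one_dvd_of_residue_sums hq a _ h₂
  have hqR : (q : ℝ) ≠ 0 := by positivity
  have hcoeff := coeff_geom_sum_mul_geom_sum p q
  have hcopP := isCoprime_geom_sum hcop
  have gp := geom_sum_mul (X : ℝ[X]) p
  have gq := geom_sum_mul (X : ℝ[X]) q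
  have geom_dvd : ∀ m : ℕ, (X - 1 : ℝ[X]) ∣ ∑ i ∈ Finset.range m, (X : ℝ[X]) ^ i - C (m : ℝ) := by
    intro m
    rw [← C_1, dvd_iff_isRoot]
    simp [eval_finsetSum]
  obtain ⟨sp, hsp⟩ := geom_dvd p
  obtain ⟨sq, hsq⟩ := geom_dvd q
  have degp : (∑ i ∈ Finset.range p, (X : ℝ[X]) ^ i).degree = ((p - 1 : ℕ) : WithBot ℕ) := by
    have := (monic_geom_sum_X (R := ℝ) hp.ne')
    have h2 : ((∑ i ∈ Finset.range p, (X : ℝ[X]) ^ i) * (X - C 1)).natDegree = p := by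
      rw [C_1, gp, ← C_1, natDegree_X_pow_sub_C]
    rw [this.natDegree_mul (monic_X_sub_C 1), natDegree_X_sub_C] at h2
    rw [degree_eq_natDegree this.ne_zero]
    congr 1; omega
  have degq : (∑ i ∈ Finset.range q, (X : ℝ[X]) ^ i).degree = ((q - 1 : ℕ) : WithBot ℕ) := by
    have := (monic_geom_sum_X (R := ℝ) hq.ne')
    have h2 : ((∑ i ∈ Finset.range q, (X : ℝ[X]) ^ i) * (X - C 1)).natDegree = q := by
      rw [C_1, gq, ← C_1, natDegree_X_pow_sub_C]
    rw [this.natDegree_mul (monic_X_sub_C 1), natDegree_X_sub_C] at h2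
    rw [degree_eq_natDegree this.ne_zero]
    congr 1; omega
  have hA : (∑ i ∈ Finset.range (p + q - 1), C (a i) * (X : ℝ[X]) ^ i).degree
      < ((p + q - 1 : ℕ) : WithBot ℕ) := by
    refine (degree_sum_le _ _).trans_lt ((Finset.sup_lt_iff (WithBot.bot_lt_coe _)).2 ?_)
    intro i hi
    exact (degree_C_mul_X_pow_le _ _).trans_lt (by exact_mod_cast Finset.mem_range.1 hi)
  have hAn : (∑ i ∈ Finset.range (p + q - 1), C (a i) * (X : ℝ[X]) ^ i).coeff n = a n := by
    simp [coeff_X_pow, hn]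
  generalize (∑ i ∈ Finset.range (p + q - 1), C (a i) * (X : ℝ[X]) ^ i) = A at *
  generalize (∑ i ∈ Finset.range p, (X : ℝ[X]) ^ i) = P at *
  generalize (∑ i ∈ Finset.range q, (X : ℝ[X]) ^ i) = Q at *
  have hCq : C (q : ℝ)⁻¹ * C (q : ℝ) = 1 := by rw [← C_mul, inv_mul_cancel₀ hqR, C_1]
  set D := A - C (v / q) * (P * Q) with hD
  have e1 : D = (A - C v * P) - (P * (X - 1)) * (C (v / q) * sq) := by
    have : Q = (X - 1) * sq + C (q : ℝ) := by rw [← hsq]; ring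
    rw [hD, div_eq_mul_inv, C_mul, this]
    linear_combination (-C v * P) * hCq
  have e2 : D = (A - C (p / q * v) * Q) - (Q * (X - 1)) * (C (v / q) * sp) := by
    have : P = (X - 1) * sp + C (p : ℝ) := by rw [← hsp]; ring
    rw [hD, div_eq_mul_inv, div_eq_mul_inv, C_mul, C_mul, C_mul, this]
    ring
  have f1 : P * (X - 1) ∣ D := by
    rw [e1]; exact dvd_sub (by rwa [gp]) (dvd_mul_right _ _)
  have f2 : Q * (X - 1) ∣ D := by
    rw [e2]; exact dvd_sub (by rwa [gq]) (dvd_mul_right _ _)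
  have hX : (X - 1 : ℝ[X]) ≠ 0 := X_sub_C_ne_zero 1
  have f3 : P * Q * (X - 1) ∣ D := by
    obtain ⟨R, hR⟩ := (dvd_mul_left _ _).trans f1
    rw [hR, mul_comm P, mul_dvd_mul_iff_left hX] at f1
    rw [hR, mul_comm Q, mul_dvd_mul_iff_left hX] at f2
    rw [hR, mul_comm _ (X - 1)]
    exact mul_dvd_mul_left _ (hcopP.mul_dvd f1 f2)
  have hdegPQ : (P * Q).degree = ((p + q - 2 : ℕ) : WithBot ℕ) := by
    rw [degree_mul, degp, degq, ← Nat.cast_add]; congr 1; omega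
  have hD0 : D = 0 := by
    refine eq_zero_of_dvd_of_degree_lt f3 ?_
    rw [degree_mul, hdegPQ, ← C_1, degree_X_sub_C]
    have : ((p + q - 2 : ℕ) : WithBot ℕ) + 1 = ((p + q - 1 : ℕ) : WithBot ℕ) := by
      rw [← Nat.cast_one, ← Nat.cast_add]; congr 1; omega
    rw [this]
    refine (degree_sub_le _ _).trans_lt (max_lt hA ?_)
    rw [← smul_eq_C_mul]
    refine (degree_smul_le _ _).trans_lt ?_
    rw [hdegPQ]
    exact_mod_cast (by omega : p + q - 2 < p + q - 1)
  have := congrArg (fun F => coeff F n) (sub_eq_zero.1 hD0)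
  simp only [coeff_C_mul, hAn, hcoeff] at this
  rw [this]; ring

lemma measureReal_residue_sum {p m N : ℕ} (hp : 0 < p) (hm : 0 < m) (μ : Measure ℝ)
    [IsProbabilityMeasure μ]
    (hμ : (μ.map fun x => (p / m : ℝ) * x).map Int.fract = volume.restrict (Ico (0 : ℝ) 1))
    (hN : μ (Ico (0 : ℝ) (N / p))ᶜ = 0) {B : Set ℝ} (hB : MeasurableSet B)
    (hBsub : B ⊆ Ico (0 : ℝ) (1 / p)) {r : ℕ} (hr : r < m) :
    ∑ i ∈ Finset.range N with i % m = r, μ.real ((fun x => x - (i : ℝ) / p) ⁻¹' B) =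
      p / m * volume.real B := by
  have hpR : (0 : ℝ) < p := by positivity
  have hmR : (0 : ℝ) < m := by positivity
  have hmeas : ∀ i : ℕ, MeasurableSet ((fun x => x - (i : ℝ) / p) ⁻¹' B) := fun i =>
    (measurable_id.sub_const _) hB
  set B' : Set ℝ := (fun y => (m / p : ℝ) * y) ⁻¹' ((fun x => x - (r : ℝ) / p) ⁻¹' B) with hB'
  have hB'meas : MeasurableSet B' := (measurable_const_mul _) (hmeas r)
  have hmem : ∀ {i : ℕ} {x : ℝ}, x - (i : ℝ) / p ∈ B → (i : ℝ) ≤ p * x ∧ p * x < i + 1 := by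
    intro i x hx
    obtain ⟨h0, h1⟩ := hBsub hx
    have e : p * x = p * (x - i / p) + i := by field_simp; ring
    have h1' : p * (x - i / p) < 1 := by
      rw [lt_div_iff₀ hpR] at h1; linarith
    have h0' : 0 ≤ p * (x - i / p) := by positivity
    constructor <;> linarith
  have hB'sub : B' ⊆ Ico (0 : ℝ) 1 := by
    intro y hy
    obtain ⟨h0, h1⟩ := hmem hy
    have e : (p : ℝ) * (m / p * y) = m * y := by field_simp
    rw [e] at h0 h1
    have hr' : (r : ℝ) + 1 ≤ m := by exact_mod_cast hr
    have : (0 : ℝ) ≤ r := by positivity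
    constructor <;> nlinarith
  have hvol : volume.real B' = p / m * volume.real B := by
    rw [hB', measureReal_def, Real.volume_preimage_mul_left (by positivity)]
    have : volume ((fun x => x - (r : ℝ) / p) ⁻¹' B) = volume B := by
      simp_rw [sub_eq_add_neg]; exact measure_preimage_add_right _ _ _
    rw [this, ENNReal.toReal_mul, ENNReal.toReal_ofReal (by positivity), abs_of_pos (by positivity),
      inv_div, measureReal_def]
  have hcov : μ.real ((fun x => Int.fract ((p / m : ℝ) * x)) ⁻¹' B') = volume.real B' := by
    have := congrArg (fun ν => ν.real B') hμ
    simp only [measureReal_def] at this ⊢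
    rwa [Measure.map_map measurable_fract (measurable_const_mul _),
      Measure.map_apply (measurable_fract.comp (measurable_const_mul _)) hB'meas,
      Measure.restrict_apply hB'meas, inter_eq_left.2 hB'sub] at this
  have hset : (fun x => Int.fract ((p / m : ℝ) * x)) ⁻¹' B' ∩ Ico (0 : ℝ) (N / p) =
      (⋃ i ∈ {i ∈ Finset.range N | i % m = r}, (fun x => x - (i : ℝ) / p) ⁻¹' B) ∩
        Ico (0 : ℝ) (N / p) := by
    ext x
    simp only [mem_inter_iff, and_congr_left_iff, mem_iUnion, mem_preimage, hB', exists_prop,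
      Finset.mem_filter, Finset.mem_range]
    rintro ⟨hx0, hxN⟩
    constructor
    · intro hx
      have hk : 0 ≤ ⌊(p / m : ℝ) * x⌋ := Int.floor_nonneg.2 (by positivity)
      obtain ⟨k, hk⟩ := Int.eq_ofNat_of_zero_le hk
      have hfl : Int.fract ((p / m : ℝ) * x) = p / m * x - k := by
        rw [Int.fract, hk]; simp
      have hx' : x - ((r + m * k : ℕ) : ℝ) / p ∈ B := by
        rw [hfl] at hx
        convert hx using 1
        push_cast; field_simp; ring
      refine ⟨r + m * k, ⟨?_, ?_⟩, hx'⟩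
      · have := (hmem hx').1
        rw [lt_div_iff₀ hpR] at hxN
        have : ((r + m * k : ℕ) : ℝ) < N := by linarith
        exact_mod_cast this
      · rw [Nat.add_mul_mod_self_left, Nat.mod_eq_of_lt hr]
    · rintro ⟨i, ⟨-, hi⟩, hx⟩
      obtain ⟨h0, h1⟩ := hmem hx
      have hi' : (i : ℝ) = r + m * (i / m : ℕ) := by
        rw [← hi]; exact_mod_cast (Nat.mod_add_div i m).symm
      generalize i / m = k at hi'
      have hfr : Int.fract ((p / m : ℝ) * x) = p / m * x - k := by
        rw [Int.fract_eq_iff]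
        have hr' : (r : ℝ) + 1 ≤ m := by exact_mod_cast hr
        have hr0 : (0 : ℝ) ≤ r := by positivity
        have e : (p / m : ℝ) * x - k = (p * x - m * k) / m := by field_simp
        refine ⟨?_, ?_, k, by simp⟩
        · rw [e]; apply div_nonneg _ hmR.le; linarith
        · rw [e, div_lt_one hmR]; linarith
      rw [hfr]
      convert hx using 1
      rw [hi']; field_simp; ring
  have hnull : ∀ s : Set ℝ, μ.real (s ∩ Ico (0 : ℝ) (N / p)) = μ.real s := fun s => by
    rw [measureReal_def, measureReal_def, measure_inter_conull hN]
  rw [← hvol, ← hcov, ← hnull, hset, hnull, measureReal_biUnion_finset]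
  · intro i _ j _ hij
    refine Set.disjoint_left.2 fun x hx hx' => hij ?_
    obtain ⟨h0, h1⟩ := hmem hx
    obtain ⟨h0', h1'⟩ := hmem hx'
    have a1 : (i : ℝ) < j + 1 := by linarith
    have a2 : (j : ℝ) < i + 1 := by linarith
    norm_cast at a1 a2
    omega
  · exact fun i _ => hmeas i

lemma rhoQ_of_notMem {p q : ℕ} (hp : 0 < p) (hq : 0 < q) {t : ℝ}
    (ht : t ∉ Ico (0 : ℝ) ((p + q - 1 : ℕ) / p)) : rhoQ p q t = 0 := by
  have hpR : (0 : ℝ) < p := by positivity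
  have hq1 : (1 : ℝ) ≤ q := by exact_mod_cast hq
  have hc : ((p + q - 1 : ℕ) : ℝ) / p = 1 + (q - 1) / p := by
    rw [Nat.cast_sub (by omega)]; push_cast; field_simp; ring
  rw [hc] at ht
  have hq0 : 0 ≤ ((q : ℝ) - 1) / p := div_nonneg (by linarith) hpR.le
  rw [rhoQ, Finset.sum_eq_zero, indicator_of_notMem, add_zero]
  · exact fun h => ht ⟨hq0.trans h.1, by linarith [h.2]⟩
  · intro j hj
    rw [Finset.mem_Icc] at hj
    have hj1 : (1 : ℝ) ≤ j := by exact_mod_cast hj.1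
    have hjq : (j : ℝ) + 1 ≤ q := by exact_mod_cast (by omega : j + 1 ≤ q)
    rw [indicator_of_notMem, mul_zero]
    rintro (h | h)
    · refine ht ⟨le_trans (div_nonneg (by linarith) hpR.le) h.1, h.2.trans_le ?_⟩
      have : (j : ℝ) / p ≤ (q - 1) / p := by gcongr; linarith
      linarith
    · refine ht ⟨le_trans ?_ h.1, h.2.trans_le ?_⟩
      · have : 0 ≤ ((q : ℝ) - j - 1) / p := div_nonneg (by linarith) hpR.le
        linarith
      · gcongr

lemma rhoQ_of_mem {p q : ℕ} (hq : 0 < q) (hqp : q < p) {n : ℕ} (hn : n < p + q - 1) {t : ℝ}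
    (ht : t ∈ Ico ((n : ℝ) / p) ((n + 1 : ℝ) / p)) :
    rhoQ p q t = (min q (n + 1) - (n + 1 - p) : ℕ) / q := by
  have hpR : (0 : ℝ) < p := by exact_mod_cast hq.trans hqp
  have hIco : ∀ a b : ℤ, t ∈ Ico ((a : ℝ) / p) ((b : ℝ) / p) ↔ a ≤ n ∧ n < b := by
    intro a b
    obtain ⟨h0, h1⟩ := ht
    rw [div_le_iff₀ hpR] at h0
    rw [lt_div_iff₀ hpR] at h1
    rw [mem_Ico, div_le_iff₀ hpR, lt_div_iff₀ hpR]
    constructor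
    · rintro ⟨h2, h3⟩
      have a1 : (a : ℝ) < n + 1 := by linarith
      have a2 : (n : ℝ) < b := by linarith
      norm_cast at a1 a2
      exact ⟨by omega, a2⟩
    · rintro ⟨h2, h3⟩
      have a1 : (a : ℝ) ≤ n := by exact_mod_cast h2
      have a2 : (n : ℝ) + 1 ≤ b := by exact_mod_cast (by omega : (n : ℤ) + 1 ≤ b)
      constructor <;> linarith
  have m1 : ∀ j : ℕ, t ∈ Ico (((j : ℝ) - 1) / p) ((j : ℝ) / p) ↔ n + 1 = j := by
    intro j
    have := hIco (j - 1) j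
    push_cast at this
    rw [this]; omega
  have m2 : ∀ j : ℕ, t ∈ Ico (1 + ((q : ℝ) - (j : ℝ) - 1) / p) (1 + ((q : ℝ) - (j : ℝ)) / p) ↔
      n + 1 + j = p + q := by
    intro j
    have := hIco (p + (q - j - 1)) (p + (q - j))
    push_cast at this
    rw [add_div, add_div, div_self hpR.ne'] at this
    rw [this]; omega
  have m3 : t ∈ Ico (((q : ℝ) - 1) / p) 1 ↔ q ≤ n + 1 ∧ n < p := by
    have := hIco (q - 1) p
    push_cast at this
    rw [div_self hpR.ne'] at this
    rw [this]; omega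
  have hsum : rhoQ p q t = (∑ j ∈ Finset.Icc 1 (q - 1), ((j : ℝ) / q) *
      if n + 1 = j ∨ n + 1 + j = p + q then 1 else 0) + if q ≤ n + 1 ∧ n < p then 1 else 0 := by
    classical
    simp only [rhoQ, indicator_apply, mem_union, m1, m2, m3, Pi.one_apply]
  rw [hsum]
  simp only [mul_ite, mul_one, mul_zero]
  rcases lt_or_ge (n + 1) q with h1 | h1
  · rw [if_neg (by omega), Finset.sum_eq_single (n + 1), if_pos (by omega), add_zero]
    · congr 2; omega
    · intro j hj hne
      rw [Finset.mem_Icc] at hj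
      rw [if_neg (by omega)]
    · intro h; rw [Finset.mem_Icc] at h; omega
  rcases lt_or_ge n p with h2 | h2
  · rw [if_pos ⟨h1, h2⟩, Finset.sum_eq_zero, zero_add]
    · rw [show min q (n + 1) - (n + 1 - p) = q by omega, div_self]
      exact_mod_cast hq.ne'
    · intro j hj
      rw [Finset.mem_Icc] at hj
      rw [if_neg (by omega)]
  · rw [if_neg (by omega), Finset.sum_eq_single (p + q - (n + 1)), if_pos (by omega), add_zero]
    · congr 2; omega
    · intro j hj hne
      rw [Finset.mem_Icc] at hj
      rw [if_neg (by omega)]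
    · intro h; rw [Finset.mem_Icc] at h; omega

lemma measure_compl_eq_zero_of_msupp_subset {μ : Measure ℝ} {s : Set ℝ} (h : msupp μ ⊆ s) :
    μ sᶜ = 0 := by
  refine measure_null_of_locally_null _ fun x hx => ?_
  have : x ∉ msupp μ := fun hx' => hx (h hx')
  simp only [msupp, mem_ofPred_eq, not_forall, not_lt, nonpos_iff_eq_zero] at this
  obtain ⟨U, hU, h0⟩ := this
  exact ⟨U, mem_nhdsWithin_of_mem_nhds hU, h0⟩

theorem stmt_16 (p q : ℕ) (hp : 0 < p) (hq : 0 < q) (hcop : Nat.Coprime p q)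
    (β : ℝ) (hβdef : β = (p : ℝ) / q) (hβ : 1 < β) (hnotint : ¬ ∃ n : ℤ, β = (n : ℝ))
    (μ : Measure ℝ) [IsProbabilityMeasure μ] (h : IsCIUPM (T 0 β) μ)
    (hsupp : msupp μ ⊆ Icc (0 : ℝ) (1 + ((q : ℝ) - 1) / p))
    (hdiam : EMetric.diam (msupp μ) = ENNReal.ofReal (1 + ((q : ℝ) - 1) / p)) :
    μ = volume.withDensity (fun t => ENNReal.ofReal (rhoQ p q t)) := by
  obtain ⟨h₁, h₂⟩ := h
  have hpR : (0 : ℝ) < p := by positivity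
  have hqR : (0 : ℝ) < q := by positivity
  have hqp : q < p := by
    rw [hβdef, lt_div_iff₀ hqR, one_mul] at hβ
    exact_mod_cast hβ
  have hc : 1 + ((q : ℝ) - 1) / p = ((p + q - 1 : ℕ) : ℝ) / p := by
    rw [Nat.cast_sub (by omega)]; push_cast; field_simp; ring
  have hsing : ∀ x : ℝ, μ {x} = 0 := by
    intro x
    have hle : ({x} : Set ℝ) ⊆ Int.fract ⁻¹' {Int.fract x} := by simp
    refine measure_mono_null hle ?_
    rw [← Measure.map_apply measurable_fract (measurableSet_singleton _), h₁]
    simp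
  have hnull : μ (Ico (0 : ℝ) ((p + q - 1 : ℕ) / p))ᶜ = 0 := by
    rw [hc] at hsupp
    refine measure_mono_null ?_ (measure_union_null
      (measure_compl_eq_zero_of_msupp_subset hsupp) (hsing (((p + q - 1 : ℕ) : ℝ) / p)))
    intro x hx
    by_cases hxe : x = ((p + q - 1 : ℕ) : ℝ) / p
    · exact Or.inr hxe
    · exact Or.inl fun hx' => hx ⟨hx'.1, lt_of_le_of_ne hx'.2 hxe⟩
  have hp' : (μ.map fun x => (p / p : ℝ) * x).map Int.fract = volume.restrict (Ico (0 : ℝ) 1) := by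
    simpa [div_self hpR.ne'] using h₁
  have hq' : (μ.map fun x => (p / q : ℝ) * x).map Int.fract = volume.restrict (Ico (0 : ℝ) 1) := by
    have : T 0 β = fun x => (p / q : ℝ) * x := by funext x; simp [T, hβdef]
    rwa [this] at h₂
  set ν := volume.withDensity (fun t => ENNReal.ofReal (rhoQ p q t)) with hν
  have hνnull : ν (Ico (0 : ℝ) ((p + q - 1 : ℕ) / p))ᶜ = 0 := by
    rw [hν, withDensity_apply _ measurableSet_Ico.compl,
      setLIntegral_congr_fun (g := fun _ => 0) measurableSet_Ico.compl]
    · simp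
    · intro t ht
      simp [rhoQ_of_notMem hp hq ht]
  have hcov : Ico (0 : ℝ) ((p + q - 1 : ℕ) / p) ⊆
      ⋃ n : Fin (p + q - 1), Ico ((n : ℝ) / p) (((n : ℕ) + 1 : ℝ) / p) := by
    rintro x ⟨h0, h1⟩
    rw [lt_div_iff₀ hpR] at h1
    have hx : 0 ≤ x * p := by positivity
    refine mem_iUnion.2 ⟨⟨⌊x * p⌋₊, (Nat.floor_lt hx).2 h1⟩, ?_⟩
    rw [mem_Ico, div_le_iff₀ hpR, lt_div_iff₀ hpR]
    exact ⟨Nat.floor_le hx, Nat.lt_floor_add_one _⟩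
  have hrestrict : ∀ κ : Measure ℝ, κ (Ico (0 : ℝ) ((p + q - 1 : ℕ) / p))ᶜ = 0 →
      κ.restrict (⋃ n : Fin (p + q - 1), Ico ((n : ℝ) / p) (((n : ℕ) + 1 : ℝ) / p)) = κ :=
    fun κ hκ => Measure.restrict_eq_self_of_ae_mem
      (measure_mono_null (compl_subset_compl.2 hcov) hκ)
  rw [← hrestrict μ hnull, ← hrestrict ν hνnull, Measure.restrict_iUnion_congr]
  rintro ⟨n, hn⟩
  ext E hE
  rw [Measure.restrict_apply hE, Measure.restrict_apply hE]
  simp only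
  set F := E ∩ Ico ((n : ℝ) / p) (((n : ℕ) + 1 : ℝ) / p) with hF
  have hFm : MeasurableSet F := hE.inter measurableSet_Ico
  have hνF : ν F = ENNReal.ofReal ((min q (n + 1) - (n + 1 - p) : ℕ) / q) * volume F := by
    rw [hν, withDensity_apply _ hFm, setLIntegral_congr_fun (g := fun _ =>
      ENNReal.ofReal ((min q (n + 1) - (n + 1 - p) : ℕ) / q)) hFm, setLIntegral_const]
    intro t ht
    simp only [rhoQ_of_mem hq hqp hn ht.2]
  set B := (fun x => x + (n : ℝ) / p) ⁻¹' F with hB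
  have hBm : MeasurableSet B := (measurable_id.add_const _) hFm
  have hBsub : B ⊆ Ico (0 : ℝ) (1 / p) := by
    rintro x ⟨-, h0, h1⟩
    rw [add_div] at h1
    constructor <;> linarith
  have hBF : (fun x => x - (n : ℝ) / p) ⁻¹' B = F := by
    rw [hB, ← preimage_comp]; convert preimage_id; ext x; simp
  have hvol : volume B = volume F := measure_preimage_add_right _ _ _
  have hFfin : volume F ≠ ⊤ :=
    ((measure_mono inter_subset_right).trans_lt measure_Ico_lt_top).ne
  have key := eq_coeff_of_residue_sums hp hq hcop
    (fun i => μ.real ((fun x => x - (i : ℝ) / p) ⁻¹' B)) (volume.real B)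
    (fun r hr => by
      rw [measureReal_residue_sum hp hp μ hp' hnull hBm hBsub hr, div_self hpR.ne', one_mul])
    (fun r hr => measureReal_residue_sum hp hq μ hq' hnull hBm hBsub hr) hn
  simp only [hBF] at key
  rw [hνF, ← ofReal_measureReal (μ := μ), key, ENNReal.ofReal_mul (by positivity), measureReal_def,
    hvol, ENNReal.ofReal_toReal hFfin]
end

section
/- Let k be a nonzero integer and α ∈ ℝ. The Borel probability measure μ = λ|_{[0,1/2]} + λ|_{[3/2,2]} (where λ|_A denotes Lebesgue measure restricted to A), i.e., the measure with density equal to 1 on [0,1/2] ∪ [3/2,2] and 0 elsewhere, is a CIUPM for T_{α,k}(x) = kx + α, and the Lebesgue measure of its support equals 1 while the diameter of its support equals 2. -/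
open MeasureTheory Set

/-- The fractional part maps Lebesgue measure on an integer translate of a subset of `[0,1)` to
Lebesgue measure on that subset. -/
theorem map_fract_restrict_preimage_sub_int {s : Set ℝ} (hs : MeasurableSet s)
    (h : s ⊆ Ico 0 1) (n : ℤ) :
    (volume.restrict ((fun x : ℝ => x - n) ⁻¹' s)).map Int.fract = volume.restrict s := by
  have hp := (measurePreserving_sub_right (volume : Measure ℝ) (n : ℝ)).restrict_preimage hs
  rw [← hp.map_eq]
  refine Measure.map_congr ((ae_restrict_iff' (hs.preimage (by fun_prop))).2 (.of_forall ?_))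
  intro x hx
  have := h hx
  rw [← Int.fract_sub_intCast x n, Int.fract_eq_self.2 this]

/-- The fractional part of a nonconstant integer-slope affine map preserves Lebesgue measure
on `[0,1)`. -/
theorem map_fract_T_restrict_Ico (α : ℝ) {k : ℤ} (hk : k ≠ 0) :
    (volume.restrict (Ico (0 : ℝ) 1)).map (fun x => Int.fract (T α k x)) =
      volume.restrict (Ico (0 : ℝ) 1) := by
  let g : UnitAddCircle → ℝ := fun y => AddCircle.measurableEquivIco 1 0 y
  have hg : Measurable g :=
    measurable_subtype_coe.comp (AddCircle.measurableEquivIco 1 0).measurable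
  have hgm (x : ℝ) : g (x : UnitAddCircle) = Int.fract x := by
    have := AddCircle.coe_equivIco_mk_apply (1 : ℝ) x
    rwa [div_one, mul_one] at this
  have hmk : MeasurePreserving ((↑) : ℝ → UnitAddCircle) (volume.restrict (Ico (0 : ℝ) 1)) := by
    have := UnitAddCircle.measurePreserving_mk 0
    rwa [zero_add, Measure.restrict_congr_set Ico_ae_eq_Ioc.symm] at this
  have hgmap : (volume : Measure UnitAddCircle).map g = volume.restrict (Ico (0 : ℝ) 1) := by
    rw [← hmk.map_eq, Measure.map_map hg hmk.measurable]
    have : g ∘ ((↑) : ℝ → UnitAddCircle) = Int.fract := funext hgm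
    rw [this]
    simpa using map_fract_restrict_preimage_sub_int measurableSet_Ico (Subset.refl (Ico (0 : ℝ) 1)) 0
  have hT : MeasurePreserving (fun y : UnitAddCircle => k • y + (α : UnitAddCircle)) :=
    (measurePreserving_add_right volume (α : UnitAddCircle)).comp
      (Measure.measurePreserving_zsmul volume hk)
  have hfun : (fun x => Int.fract (T α k x)) =
      g ∘ (fun y : UnitAddCircle => k • y + (α : UnitAddCircle)) ∘ ((↑) : ℝ → UnitAddCircle) := by
    funext x
    simp only [Function.comp_apply, ← hgm, T]
    congr 1
    rw [← AddCircle.coe_zsmul, ← AddCircle.coe_add, zsmul_eq_mul]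
  rw [hfun, ← Measure.map_map hg (hT.comp hmk).measurable, (hT.comp hmk).map_eq, hgmap]

/-- A measure uniform modulo one is circularly invariant under every integer-slope affine map. -/
theorem isCIUPM_T_of_map_fract_eq (α : ℝ) {k : ℤ} (hk : k ≠ 0) {μ : Measure ℝ}
    (hμ : μ.map Int.fract = volume.restrict (Ico (0 : ℝ) 1)) : IsCIUPM (T α k) μ := by
  have hTm : Measurable (T α k) := by unfold T; fun_prop
  refine ⟨hμ, ?_⟩
  have hfun : Int.fract ∘ T α k = (fun x => Int.fract (T α k x)) ∘ Int.fract := by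
    funext x
    rw [Function.comp_apply, Function.comp_apply, Int.fract_eq_fract]
    refine ⟨k * ⌊x⌋, ?_⟩
    simp only [T, Int.fract]
    push_cast
    ring
  rw [Measure.map_map measurable_fract hTm, hfun,
    ← Measure.map_map (g := fun x => Int.fract (T α k x)) (measurable_fract.comp hTm)
      measurable_fract, hμ, map_fract_T_restrict_Ico α hk]

theorem msupp_add (μ ν : Measure ℝ) : msupp (μ + ν) = msupp μ ∪ msupp ν := by
  ext x
  simp only [msupp, mem_union, mem_ofPred_eq, Measure.add_apply]
  constructor
  · intro h
    by_contra! hc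
    obtain ⟨⟨U, hU, hU0⟩, V, hV, hV0⟩ := hc
    have := h (U ∩ V) (Filter.inter_mem hU hV)
    rw [measure_mono_null inter_subset_left (nonpos_iff_eq_zero.1 hU0),
      measure_mono_null inter_subset_right (nonpos_iff_eq_zero.1 hV0)] at this
    simp at this
  · rintro (h | h) U hU
    · exact (h U hU).trans_le le_self_add
    · exact (h U hU).trans_le le_add_self

theorem msupp_restrict_Icc {a b : ℝ} (hab : a < b) :
    msupp (volume.restrict (Icc a b)) = Icc a b := by
  ext x
  constructor
  · intro h
    by_contra hx
    have := h _ (isClosed_Icc.isOpen_compl.mem_nhds hx)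
    simp [Measure.restrict_apply measurableSet_Icc.compl] at this
  · intro hx U hU
    rw [← closure_Ioo hab.ne, mem_closure_iff_nhds] at hx
    have hne := hx _ (interior_mem_nhds.2 hU)
    calc 0 < volume (interior U ∩ Ioo a b) := (isOpen_interior.inter isOpen_Ioo).measure_pos _ hne
      _ ≤ volume (U ∩ Icc a b) :=
        measure_mono (inter_subset_inter interior_subset Ioo_subset_Icc_self)
      _ = volume.restrict (Icc a b) U := (Measure.restrict_apply' measurableSet_Icc).symm

theorem stmt_17 (α : ℝ) (k : ℤ) (hk : k ≠ 0)
    (μ : Measure ℝ)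
    (hμ : μ = volume.restrict (Icc (0 : ℝ) (1 / 2)) + volume.restrict (Icc (3 / 2 : ℝ) 2)) :
    IsProbabilityMeasure μ ∧ IsCIUPM (T α (k : ℝ)) μ ∧
      volume (msupp μ) = 1 ∧ EMetric.diam (msupp μ) = 2 := by
  have hsupp : msupp μ = Icc (0 : ℝ) (1 / 2) ∪ Icc (3 / 2 : ℝ) 2 := by
    rw [hμ, msupp_add, msupp_restrict_Icc (by norm_num), msupp_restrict_Icc (by norm_num)]
  have hvol : volume (Icc (0 : ℝ) (1 / 2)) + volume (Icc (3 / 2 : ℝ) 2) = 1 := by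
    rw [Real.volume_Icc, Real.volume_Icc, ← ENNReal.ofReal_add (by norm_num) (by norm_num)]
    norm_num
  have hfract : μ.map Int.fract = volume.restrict (Ico (0 : ℝ) 1) := by
    have h₁ := map_fract_restrict_preimage_sub_int (s := Ico (0 : ℝ) (1 / 2)) measurableSet_Ico
      (Ico_subset_Ico_right (by norm_num)) 0
    have h₂ := map_fract_restrict_preimage_sub_int (s := Ico (1 / 2 : ℝ) 1) measurableSet_Ico
      (Ico_subset_Ico_left (by norm_num)) 1
    rw [preimage_sub_const_Ico] at h₁ h₂
    norm_num at h₁ h₂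
    rw [hμ, Measure.map_add _ _ measurable_fract, Measure.restrict_congr_set Ico_ae_eq_Icc.symm,
      Measure.restrict_congr_set (Ico_ae_eq_Icc (a := (3 / 2 : ℝ))).symm]
    norm_num
    rw [h₁, h₂, ← Measure.restrict_union Ico_disjoint_Ico_same measurableSet_Ico,
      Ico_union_Ico_eq_Ico (by norm_num) (by norm_num)]
  refine ⟨⟨?_⟩, isCIUPM_T_of_map_fract_eq α hk hfract, ?_, ?_⟩
  · rw [hμ, Measure.add_apply, Measure.restrict_apply_univ, Measure.restrict_apply_univ, hvol]
  · rw [hsupp, measure_union _ measurableSet_Icc, hvol]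
    rw [Set.disjoint_left]
    rintro x ⟨-, hx⟩ ⟨hx', -⟩
    linarith
  · rw [hsupp]
    change Metric.ediam _ = 2
    apply le_antisymm
    · have hsub : Icc (0 : ℝ) (1 / 2) ∪ Icc (3 / 2 : ℝ) 2 ⊆ Icc 0 2 :=
        union_subset (Icc_subset_Icc_right (by norm_num)) (Icc_subset_Icc_left (by norm_num))
      simpa [Real.ediam_Icc] using Metric.ediam_mono hsub
    · have h0 : (0 : ℝ) ∈ Icc (0 : ℝ) (1 / 2) ∪ Icc (3 / 2 : ℝ) 2 := Or.inl (by norm_num)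
      have h2 : (2 : ℝ) ∈ Icc (0 : ℝ) (1 / 2) ∪ Icc (3 / 2 : ℝ) 2 := Or.inr (by norm_num)
      simpa [edist_dist] using Metric.edist_le_ediam_of_mem h0 h2
end

section
/- Let β = p/q ≥ 1 be rational with p, q coprime positive integers, let α ∈ ℝ, and let m, n ∈ ℤ. The Borel probability measure μ_{β,m,n} with Lebesgue density ρ_{β,m,n} defined by ρ_{β,m,n}(t) = j/q for t ∈ [mq + (j−1)/p, mq + j/p) ∪ [mq + 1 + (q−j−1)/p, mq + 1 + (q−j)/p) for j = 1, …, q−1, ρ_{β,m,n}(t) = 1 for t ∈ [nq + (q−1)/p, nq + 1), and ρ_{β,m,n}(t) = 0 elsewhere, is a CIUPM for T_{α,β}, and the Lebesgue measure of its support equals c_β = 1 + 1/β − 1/p. -/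
open MeasureTheory Set

/-- The density of `μ_{β,m,n}` for rational `β = p/q`: it equals `j/q` on
`[mq + (j−1)/p, mq + j/p) ∪ [mq + 1 + (q−j−1)/p, mq + 1 + (q−j)/p)` for
`j = 1, …, q−1`, equals `1` on `[nq + (q−1)/p, nq + 1)`, and `0` elsewhere. -/
noncomputable def rhoQmn (p q : ℕ) (m n : ℤ) : ℝ → ℝ := fun t =>
  (∑ j ∈ Finset.Icc 1 (q - 1), ((j : ℝ) / q) *
      Set.indicator
        (Set.Ico ((m : ℝ) * q + ((j : ℝ) - 1) / p) ((m : ℝ) * q + (j : ℝ) / p) ∪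
          Set.Ico ((m : ℝ) * q + 1 + ((q : ℝ) - (j : ℝ) - 1) / p)
            ((m : ℝ) * q + 1 + ((q : ℝ) - (j : ℝ)) / p)) 1 t)
    + Set.indicator (Set.Ico ((n : ℝ) * q + ((q : ℝ) - 1) / p) ((n : ℝ) * q + 1)) 1 t

/-- The integral of `f` over the `i`-th interval of length `1 / p` to the right of `c`. -/
noncomputable def cellLIntegral (p : ℕ) (f : ℝ → ENNReal) (c : ℝ) (i : ℕ) : ENNReal :=
  ∫⁻ t in Ico (c + (i : ℝ) / p) (c + ((i : ℝ) + 1) / p), f t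

lemma sum_cellLIntegral (p : ℕ) (f : ℝ → ENNReal) (c : ℝ) {a b : ℕ} (hab : a ≤ b) :
    ∑ i ∈ Finset.Ico a b, cellLIntegral p f c i
      = ∫⁻ t in Ico (c + (a : ℝ) / p) (c + (b : ℝ) / p), f t := by
  induction b, hab using Nat.le_induction with
  | base => simp
  | succ b hab ih =>
    rw [Finset.sum_Ico_succ_top hab, ih, cellLIntegral,
      ← lintegral_union measurableSet_Ico (Ico_disjoint_Ico_same), Ico_union_Ico_eq_Ico]
    · push_cast; rfl
    · gcongr
    · gcongr; linarith

lemma sum_range_cellLIntegral (p : ℕ) (f : ℝ → ENNReal) (c : ℝ) (b : ℕ) :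
    ∑ i ∈ Finset.range b, cellLIntegral p f c i = ∫⁻ t in Ico c (c + (b : ℝ) / p), f t := by
  rw [Finset.range_eq_Ico, sum_cellLIntegral p f c (Nat.zero_le b)]
  simp

lemma setLIntegral_Ico_add_right (f : ℝ → ENNReal) (a b s : ℝ) :
    ∫⁻ t in Ico (a + s) (b + s), f t = ∫⁻ t in Ico a b, f (t + s) := by
  rw [← lintegral_indicator measurableSet_Ico, ← lintegral_indicator measurableSet_Ico,
    ← lintegral_add_right_eq_self _ s]
  congr 1 with t
  simp [indicator]

lemma Function.Periodic.cellLIntegral_add {f : ℝ → ENNReal} {s : ℝ} (hf : Function.Periodic f s)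
    (p : ℕ) (c : ℝ) (i : ℕ) : cellLIntegral p f (c + s) i = cellLIntegral p f c i := by
  simp only [cellLIntegral]
  rw [add_right_comm c s, add_right_comm c s, setLIntegral_Ico_add_right]
  simp only [hf _]

lemma cellLIntegral_add_div (p : ℕ) (f : ℝ → ENNReal) (c : ℝ) (r i : ℕ) :
    cellLIntegral p f (c + (r : ℝ) / p) i = cellLIntegral p f c (i + r) := by
  simp only [cellLIntegral]
  congr 3 <;> push_cast <;> ring

lemma sum_add_of_periodic (H : ℕ → ENNReal) (r : ℕ) (hH : ∀ i, H (i + r) = H i) (a : ℕ) :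
    ∑ b ∈ Finset.range r, H (a + b) = ∑ b ∈ Finset.range r, H b := by
  induction a with
  | zero => simp
  | succ a ih =>
    rw [← ih]
    cases r with
    | zero => simp
    | succ r =>
      rw [Finset.sum_range_succ, Finset.sum_range_succ' (fun b => H (a + b))]
      congr 1
      · exact Finset.sum_congr rfl fun b _ => by congr 1; ring
      · rw [add_zero, ← hH a]; congr 1; ring

lemma sum_sum_add_eq_trapezoid (H : ℕ → ENNReal) (p k : ℕ) (hk : k + 1 ≤ p) :
    ∑ a ∈ Finset.range (k + 1), ∑ b ∈ Finset.range p, H (a + b)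
      = ∑ j ∈ Finset.range k, ((j : ENNReal) + 1) * (H j + H (k - 1 - j + p))
        + ((k : ENNReal) + 1) * ∑ i ∈ Finset.Ico k p, H i := by
  induction k with
  | zero => simp
  | succ k ih =>
    rw [Finset.sum_range_succ, ih (by omega)]
    have hrow : ∑ b ∈ Finset.range p, H (k + 1 + b)
        = ∑ i ∈ Finset.Ico (k + 1) p, H i + ∑ j ∈ Finset.range (k + 1), H (j + p) := by
      have h1 : ∑ b ∈ Finset.range p, H (k + 1 + b) = ∑ i ∈ Finset.Ico (k + 1) (k + 1 + p), H i := by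
        rw [Finset.sum_Ico_eq_sum_range]; simp
      have h2 : ∑ j ∈ Finset.range (k + 1), H (j + p) = ∑ i ∈ Finset.Ico p (k + 1 + p), H i := by
        rw [Finset.sum_Ico_eq_sum_range]
        simp [add_comm]
      rw [h1, h2, Finset.sum_Ico_consecutive _ (by omega) (by omega)]
    have hrev (F : ℕ → ENNReal) (l : ℕ) : ∑ j ∈ Finset.range l, ((j : ENNReal) + 1) * F (l - 1 - j + p)
        = ∑ j ∈ Finset.range l, ((l - 1 - j : ℕ) + 1) * F (j + p) := by
      rw [← Finset.sum_range_reflect]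
      refine Finset.sum_congr rfl fun j hj => ?_
      have := Finset.mem_range.1 hj
      rw [show l - 1 - (l - 1 - j) = j by omega]
    have htail : ∑ j ∈ Finset.range (k + 1), ((j : ENNReal) + 1) * H (k + 1 - 1 - j + p)
        = ∑ j ∈ Finset.range k, ((j : ENNReal) + 1) * H (k - 1 - j + p)
          + ∑ j ∈ Finset.range (k + 1), H (j + p) := by
      rw [hrev H (k + 1), hrev H k, Finset.sum_range_succ, Finset.sum_range_succ _ k, ← add_assoc,
        ← Finset.sum_add_distrib]
      congr 1
      · refine Finset.sum_congr rfl fun j hj => ?_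
        have := Finset.mem_range.1 hj
        rw [show k + 1 - 1 - j = k - 1 - j + 1 by omega]
        push_cast
        ring
      · simp
    have hsplit (l : ℕ) : ∑ j ∈ Finset.range l, ((j : ENNReal) + 1) * (H j + H (l - 1 - j + p))
        = ∑ j ∈ Finset.range l, ((j : ENNReal) + 1) * H j
          + ∑ j ∈ Finset.range l, ((j : ENNReal) + 1) * H (l - 1 - j + p) := by
      simp only [mul_add _ (H _), Finset.sum_add_distrib]
    rw [hsplit k, hsplit (k + 1), htail, hrow, Finset.sum_range_succ (fun j => ((j : ENNReal) + 1) * H j),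
      Finset.sum_eq_sum_Ico_succ_bot (by omega : k < p)]
    push_cast
    ring

lemma sum_Icc_one_eq_sum_range {M : Type*} [AddCommMonoid M] (F : ℕ → M) (k : ℕ) :
    ∑ j ∈ Finset.Icc 1 k, F j = ∑ j ∈ Finset.range k, F (j + 1) := by
  induction k with
  | zero => simp
  | succ k ih => rw [Finset.sum_Icc_succ_top (by omega), ih, Finset.sum_range_succ]

lemma ofReal_rhoQmn (p k : ℕ) (hk : k + 1 ≤ p) (m n : ℤ) (t : ℝ) :
    ENNReal.ofReal (rhoQmn p (k + 1) m n t)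
      = ∑ j ∈ Finset.range k, ((j : ENNReal) + 1) * ((k : ENNReal) + 1)⁻¹ *
          ((Ico ((m : ℝ) * (k + 1) + (j : ℝ) / p) ((m : ℝ) * (k + 1) + ((j : ℝ) + 1) / p)).indicator
              1 t
            + (Ico ((m : ℝ) * (k + 1) + 1 + ((k - 1 - j : ℕ) : ℝ) / p)
              ((m : ℝ) * (k + 1) + 1 + (((k - 1 - j : ℕ) : ℝ) + 1) / p)).indicator 1 t)
        + (Ico ((n : ℝ) * (k + 1) + (k : ℝ) / p) ((n : ℝ) * (k + 1) + 1)).indicator 1 t := by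
  have hp : (0 : ℝ) < p := by exact_mod_cast (by omega : 0 < p)
  have hind (s : Set ℝ) : ENNReal.ofReal (s.indicator 1 t) = s.indicator 1 t := by
    by_cases h : t ∈ s <;> simp [h]
  have hnn (s : Set ℝ) : (0 : ℝ) ≤ s.indicator 1 t := indicator_nonneg (by simp) t
  rw [rhoQmn, sum_Icc_one_eq_sum_range, ENNReal.ofReal_add
    (Finset.sum_nonneg fun j _ => mul_nonneg (by positivity) (hnn _)) (hnn _),
    ENNReal.ofReal_sum_of_nonneg fun j _ => mul_nonneg (by positivity) (hnn _), hind]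
  congr 1
  · simp only [Nat.add_sub_cancel]
    refine Finset.sum_congr rfl fun j hj => ?_
    have hj := Finset.mem_range.1 hj
    have hcast : ((k - 1 - j : ℕ) : ℝ) = (k : ℝ) - 1 - j := by
      rw [Nat.cast_sub (by omega), Nat.cast_sub (by omega)]; simp
    rw [ENNReal.ofReal_mul (by positivity), hind, indicator_union_of_disjoint]
    · congr 1
      · rw [ENNReal.ofReal_div_of_pos (by positivity), div_eq_mul_inv, ENNReal.ofReal_natCast,
          ENNReal.ofReal_natCast]
        push_cast
        rfl
      · rw [hcast]
        push_cast
        congr 4 <;> ring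
    · rw [Set.disjoint_left]
      rintro x ⟨_, h1⟩ ⟨h2, _⟩
      have h3 : ((j + 1 : ℕ) : ℝ) / p ≤ 1 := by
        rw [div_le_one hp]; exact_mod_cast (by omega : j + 1 ≤ p)
      have h4 : 0 ≤ (((k + 1 : ℕ) : ℝ) - ((j + 1 : ℕ) : ℝ) - 1) / p := by
        apply div_nonneg _ hp.le
        have : ((j + 1 : ℕ) : ℝ) ≤ k := by exact_mod_cast hj
        push_cast at *
        linarith
      linarith
  · push_cast
    congr 2
    ring

lemma lintegral_withDensity_rhoQmn (p k : ℕ) (hk : k + 1 ≤ p) (m n : ℤ) {f : ℝ → ENNReal}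
    (hf : Measurable f) :
    ∫⁻ t, f t ∂(volume.withDensity fun t => ENNReal.ofReal (rhoQmn p (k + 1) m n t))
      = ∑ j ∈ Finset.range k, ((j : ENNReal) + 1) * ((k : ENNReal) + 1)⁻¹ *
          (cellLIntegral p f ((m : ℝ) * (k + 1)) j
            + cellLIntegral p f ((m : ℝ) * (k + 1) + 1) (k - 1 - j))
        + ∫⁻ t in Ico ((n : ℝ) * (k + 1) + (k : ℝ) / p) ((n : ℝ) * (k + 1) + 1), f t := by
  have hind (a b : ℝ) : Measurable ((Ico a b).indicator (1 : ℝ → ENNReal)) :=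
    measurable_one.indicator measurableSet_Ico
  have hmul (a b : ℝ) : ∫⁻ t, (Ico a b).indicator 1 t * f t = ∫⁻ t in Ico a b, f t := by
    rw [← lintegral_indicator measurableSet_Ico]
    congr 1 with t
    by_cases h : t ∈ Ico a b <;> simp [h]
  simp only [ofReal_rhoQmn p k hk]
  rw [lintegral_withDensity_eq_lintegral_mul _ (by fun_prop) hf]
  simp only [Pi.mul_apply, add_mul _ _ (f _), Finset.sum_mul, mul_assoc _ _ (f _)]
  rw [lintegral_add_left (by fun_prop), hmul, lintegral_finsetSum _ (by fun_prop)]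
  congr 1
  refine Finset.sum_congr rfl fun j _ => ?_
  rw [lintegral_const_mul _ (by fun_prop),
    lintegral_add_left (by fun_prop), hmul, hmul]
  rfl

lemma lintegral_withDensity_rhoQmn_of_periodic (p k : ℕ) (hk : k + 1 ≤ p) (m n : ℤ)
    {f : ℝ → ENNReal} (hf : Measurable f) (hper : Function.Periodic f ((k : ℝ) + 1)) :
    ∫⁻ t, f t ∂(volume.withDensity fun t => ENNReal.ofReal (rhoQmn p (k + 1) m n t))
      = ((k : ENNReal) + 1)⁻¹ *
          ∑ a ∈ Finset.range (k + 1), ∑ b ∈ Finset.range p, cellLIntegral p f 0 (a + b) := by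
  have hp : (p : ℝ) ≠ 0 := by exact_mod_cast (by omega : p ≠ 0)
  have hshift (z : ℤ) (i : ℕ) :
      cellLIntegral p f ((z : ℝ) * (k + 1)) i = cellLIntegral p f 0 i := by
    have := (hper.int_mul z).cellLIntegral_add p 0 i
    rwa [zero_add] at this
  have hshift' (z : ℤ) (i : ℕ) :
      cellLIntegral p f ((z : ℝ) * (k + 1) + 1) i = cellLIntegral p f 0 (i + p) := by
    rw [← hshift z, ← cellLIntegral_add_div, div_self hp]
  have hplateau : ∫⁻ t in Ico ((n : ℝ) * (k + 1) + (k : ℝ) / p) ((n : ℝ) * (k + 1) + 1), f t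
      = ∑ i ∈ Finset.Ico k p, cellLIntegral p f 0 i := by
    simp only [← hshift n]
    rw [sum_cellLIntegral p f _ (by omega), div_self hp]
  have hcancel : ((k : ENNReal) + 1)⁻¹ * ((k : ENNReal) + 1) = 1 :=
    ENNReal.inv_mul_cancel (by simp) (by simp)
  rw [lintegral_withDensity_rhoQmn p k hk m n hf, sum_sum_add_eq_trapezoid _ p k hk,
    mul_add ((k : ENNReal) + 1)⁻¹,
    ← mul_assoc, hcancel, one_mul, hplateau, Finset.mul_sum]
  congr 1
  refine Finset.sum_congr rfl fun j _ => ?_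
  rw [hshift, hshift']
  ring

lemma setLIntegral_Ico_comp_affine (f : ℝ → ENNReal) (hf : Measurable f) {β : ℝ}
    (hβ : 0 < β) (α b : ℝ) :
    ENNReal.ofReal β * ∫⁻ t in Ico 0 b, f (β * t + α) = ∫⁻ t in Ico α (α + β * b), f t := by
  have h1 : ∫⁻ t in Ico α (α + β * b), f t = ∫⁻ t in Ico 0 (β * b), f (t + α) := by
    rw [← setLIntegral_Ico_add_right, zero_add, add_comm α]
  rw [h1, ← lintegral_indicator measurableSet_Ico, ← lintegral_indicator measurableSet_Ico]
  conv_rhs => rw [← Real.smul_map_volume_mul_left hβ.ne']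
  rw [lintegral_smul_measure, lintegral_map
    ((show Measurable fun t => f (t + α) by fun_prop).indicator measurableSet_Ico) (by fun_prop),
    abs_of_pos hβ, smul_eq_mul]
  congr 2 with t
  simp [indicator, hβ]

lemma Function.Periodic.setLIntegral_Ico_add_one {f : ℝ → ENNReal} (hf : Function.Periodic f 1)
    (a : ℝ) : ∫⁻ t in Ico a (a + 1), f t = ∫⁻ t in Ico 0 1, f t := by
  have h := (isAddFundamentalDomain_Ioc one_pos a).setLIntegral_eq
    (isAddFundamentalDomain_Ioc one_pos 0) f (by
      rintro ⟨g, hg⟩ x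
      obtain ⟨z, rfl⟩ := AddSubgroup.mem_zmultiples_iff.1 hg
      have := hf.zsmul z x
      simpa [AddSubmonoid.mk_vadd, add_comm] using this)
  rw [zero_add] at h
  rwa [setLIntegral_congr Ico_ae_eq_Ioc, setLIntegral_congr Ico_ae_eq_Ioc]

lemma lintegral_withDensity_rhoQmn_of_periodic_one (p k : ℕ) (hk : k + 1 ≤ p) (m n : ℤ)
    {f : ℝ → ENNReal} (hf : Measurable f) (hper : Function.Periodic f 1) :
    ∫⁻ t, f t ∂(volume.withDensity fun t => ENNReal.ofReal (rhoQmn p (k + 1) m n t))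
      = ∫⁻ t in Ico 0 1, f t := by
  have hp : (p : ℝ) ≠ 0 := by exact_mod_cast (by omega : p ≠ 0)
  have hH (i : ℕ) : cellLIntegral p f 0 (i + p) = cellLIntegral p f 0 i := by
    rw [← cellLIntegral_add_div, div_self hp, hper.cellLIntegral_add]
  have hper' : Function.Periodic f ((k : ℝ) + 1) := by
    have := hper.nat_mul (k + 1)
    simpa using this
  rw [lintegral_withDensity_rhoQmn_of_periodic p k hk m n hf hper']
  simp only [sum_add_of_periodic _ p hH]
  rw [sum_range_cellLIntegral, div_self hp, Finset.sum_const, Finset.card_range, nsmul_eq_mul,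
    ← mul_assoc]
  push_cast
  rw [ENNReal.inv_mul_cancel (by simp) (by simp), one_mul, zero_add]

lemma lintegral_withDensity_rhoQmn_comp_T (p k : ℕ) (hk : k + 1 ≤ p) (m n : ℤ) (α : ℝ)
    {f : ℝ → ENNReal} (hf : Measurable f) (hper : Function.Periodic f 1) :
    ∫⁻ t, f (T α ((p : ℝ) / (k + 1)) t)
        ∂(volume.withDensity fun t => ENNReal.ofReal (rhoQmn p (k + 1) m n t))
      = ∫⁻ t in Ico 0 1, f t := by
  have hp : (0 : ℝ) < p := by exact_mod_cast (by omega : 0 < p)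
  have hq : (0 : ℝ) < (k : ℝ) + 1 := by positivity
  set h : ℝ → ENNReal := fun t => f (T α ((p : ℝ) / (k + 1)) t) with hh
  have hmeas : Measurable h := by
    unfold T at hh
    rw [hh]
    fun_prop
  have hper1 : Function.Periodic h (((k + 1 : ℕ) : ℝ) / p) := by
    intro t
    simp only [hh, T]
    rw [← hper ((p : ℝ) / (k + 1) * t + α)]
    congr 1
    push_cast
    field_simp
    ring
  have hper2 : Function.Periodic h ((k : ℝ) + 1) := by
    have := hper1.nat_mul p
    rwa [mul_div_cancel₀ _ hp.ne', Nat.cast_succ] at this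
  have hH (i : ℕ) : cellLIntegral p h 0 (i + (k + 1)) = cellLIntegral p h 0 i := by
    rw [← cellLIntegral_add_div, hper1.cellLIntegral_add]
  have hscale := setLIntegral_Ico_comp_affine f hf (div_pos hp hq) α (((k : ℝ) + 1) / p)
  rw [show (p : ℝ) / (k + 1) * (((k : ℝ) + 1) / p) = 1 by field_simp,
    hper.setLIntegral_Ico_add_one] at hscale
  rw [lintegral_withDensity_rhoQmn_of_periodic p k hk m n hmeas hper2, Finset.sum_comm]
  simp only [add_comm _, sum_add_of_periodic _ (k + 1) hH]
  simp only [sum_range_cellLIntegral, Finset.sum_const, Finset.card_range, nsmul_eq_mul]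
  rw [← hscale, ENNReal.ofReal_div_of_pos hq, ENNReal.ofReal_natCast,
    ENNReal.ofReal_add (by positivity) zero_le_one, ENNReal.ofReal_natCast, ENNReal.ofReal_one,
    div_eq_mul_inv (p : ENNReal), ← mul_assoc, mul_comm (p : ENNReal)]
  simp [hh, T, add_comm]

lemma map_fract_eq_of_lintegral {ν : Measure ℝ}
    (h : ∀ f : ℝ → ENNReal, Measurable f → Function.Periodic f 1 →
      ∫⁻ t, f t ∂ν = ∫⁻ t in Ico 0 1, f t) :
    ν.map Int.fract = volume.restrict (Ico (0 : ℝ) 1) := by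
  refine Measure.ext_of_lintegral _ fun f hf => ?_
  rw [lintegral_map hf measurable_fract, h (fun t => f (Int.fract t)) (hf.comp measurable_fract)
    fun t => by simp]
  exact setLIntegral_congr_fun measurableSet_Ico fun t ht => by
    rw [Int.fract_eq_self.2 ht]

lemma isCIUPM_withDensity_rhoQmn (p k : ℕ) (hk : k + 1 ≤ p) (m n : ℤ) (α : ℝ) :
    IsCIUPM (T α ((p : ℝ) / (k + 1)))
      (volume.withDensity fun t => ENNReal.ofReal (rhoQmn p (k + 1) m n t)) := by
  refine ⟨map_fract_eq_of_lintegral fun f hf hper =>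
    lintegral_withDensity_rhoQmn_of_periodic_one p k hk m n hf hper,
    map_fract_eq_of_lintegral fun f hf hper => ?_⟩
  rw [lintegral_map hf (by unfold T; fun_prop)]
  exact lintegral_withDensity_rhoQmn_comp_T p k hk m n α hf hper

lemma IsCIUPM.isProbabilityMeasure {S : ℝ → ℝ} {μ : Measure ℝ} (h : IsCIUPM S μ) :
    IsProbabilityMeasure μ := by
  constructor
  have := congrArg (fun ν : Measure ℝ => ν univ) h.1
  simpa [Measure.map_apply measurable_fract] using this

lemma sum_cellLIntegral_add (p k : ℕ) (f : ℝ → ENNReal) (c d : ℝ) :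
    ∑ j ∈ Finset.range k, (cellLIntegral p f c j + cellLIntegral p f d (k - 1 - j))
      = (∫⁻ t in Ico c (c + (k : ℝ) / p), f t) + ∫⁻ t in Ico d (d + (k : ℝ) / p), f t := by
  rw [Finset.sum_add_distrib, Finset.sum_range_reflect, sum_range_cellLIntegral,
    sum_range_cellLIntegral]

lemma lintegral_withDensity_rhoQmn_le (p k : ℕ) (hk : k + 1 ≤ p) (m n : ℤ) {f : ℝ → ENNReal}
    (hf : Measurable f) :
    ∫⁻ t, f t ∂(volume.withDensity fun t => ENNReal.ofReal (rhoQmn p (k + 1) m n t))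
      ≤ (∫⁻ t in Ico ((m : ℝ) * (k + 1)) ((m : ℝ) * (k + 1) + (k : ℝ) / p), f t)
        + (∫⁻ t in Ico ((m : ℝ) * (k + 1) + 1) ((m : ℝ) * (k + 1) + 1 + (k : ℝ) / p), f t)
        + ∫⁻ t in Ico ((n : ℝ) * (k + 1) + (k : ℝ) / p) ((n : ℝ) * (k + 1) + 1), f t := by
  rw [lintegral_withDensity_rhoQmn p k hk m n hf, ← sum_cellLIntegral_add]
  gcongr with j hj
  refine mul_le_of_le_one_left zero_le ?_
  rw [← div_eq_mul_inv]
  refine ENNReal.div_le_of_le_mul ?_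
  rw [one_mul]
  gcongr
  exact (Finset.mem_range.1 hj).le

lemma le_lintegral_withDensity_rhoQmn (p k : ℕ) (hk : k + 1 ≤ p) (m n : ℤ) {f : ℝ → ENNReal}
    (hf : Measurable f) :
    ((k : ENNReal) + 1)⁻¹ *
      ((∫⁻ t in Ico ((m : ℝ) * (k + 1)) ((m : ℝ) * (k + 1) + (k : ℝ) / p), f t)
        + (∫⁻ t in Ico ((m : ℝ) * (k + 1) + 1) ((m : ℝ) * (k + 1) + 1 + (k : ℝ) / p), f t)
        + ∫⁻ t in Ico ((n : ℝ) * (k + 1) + (k : ℝ) / p) ((n : ℝ) * (k + 1) + 1), f t)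
      ≤ ∫⁻ t, f t ∂(volume.withDensity fun t => ENNReal.ofReal (rhoQmn p (k + 1) m n t)) := by
  rw [lintegral_withDensity_rhoQmn p k hk m n hf, ← sum_cellLIntegral_add, mul_add,
    Finset.mul_sum]
  gcongr with j hj
  · exact le_mul_of_one_le_left zero_le (by simp)
  · exact mul_le_of_le_one_left zero_le (by simp)

/-- A measure squeezed between two multiples of Lebesgue measure on three intervals is supported
on the union of these intervals. -/
lemma volume_msupp_of_le {μ : Measure ℝ} {a₁ b₁ a₂ b₂ a₃ b₃ : ℝ} {c : ENNReal} (hc : c ≠ 0)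
    (h₁₂ : Disjoint (Ioo a₁ b₁) (Ioo a₂ b₂)) (h₁₃ : Disjoint (Ioo a₁ b₁) (Ioo a₃ b₃))
    (h₂₃ : Disjoint (Ioo a₂ b₂) (Ioo a₃ b₃))
    (hle : ∀ s, MeasurableSet s →
      μ s ≤ volume (s ∩ Ico a₁ b₁) + volume (s ∩ Ico a₂ b₂) + volume (s ∩ Ico a₃ b₃))
    (hge : ∀ s, MeasurableSet s →
      c * (volume (s ∩ Ico a₁ b₁) + volume (s ∩ Ico a₂ b₂) + volume (s ∩ Ico a₃ b₃)) ≤ μ s) :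
    volume (msupp μ)
      = ENNReal.ofReal (b₁ - a₁) + ENNReal.ofReal (b₂ - a₂) + ENNReal.ofReal (b₃ - a₃) := by
  apply le_antisymm
  · have hsub : msupp μ ⊆ Icc a₁ b₁ ∪ Icc a₂ b₂ ∪ Icc a₃ b₃ := by
      intro x hx
      by_contra hxn
      have hopen : IsOpen (Icc a₁ b₁ ∪ Icc a₂ b₂ ∪ Icc a₃ b₃)ᶜ :=
        ((isClosed_Icc.union isClosed_Icc).union isClosed_Icc).isOpen_compl
      have hpos := hx _ (hopen.mem_nhds hxn)
      have hempty {u v : ℝ} (h : Icc u v ⊆ Icc a₁ b₁ ∪ Icc a₂ b₂ ∪ Icc a₃ b₃) :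
          (Icc a₁ b₁ ∪ Icc a₂ b₂ ∪ Icc a₃ b₃)ᶜ ∩ Ico u v = ∅ :=
        (disjoint_compl_left_iff_subset.2 (Ico_subset_Icc_self.trans h)).inter_eq
      have := hle _ hopen.measurableSet
      rw [hempty (subset_union_left.trans subset_union_left),
        hempty (subset_union_right.trans subset_union_left), hempty subset_union_right] at this
      simp only [measure_empty, add_zero, nonpos_iff_eq_zero] at this
      exact hpos.ne' this
    refine (measure_mono hsub).trans ((measure_union_le _ _).trans ?_)
    grw [measure_union_le]
    simp
  · have hmem {x a b : ℝ} (hx : x ∈ Ioo a b) (hab : ∀ s, MeasurableSet s →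
        c * volume (s ∩ Ico a b) ≤ μ s) : x ∈ msupp μ := by
      intro U hU
      obtain ⟨V, hVU, hV, hxV⟩ := mem_nhds_iff.1 (Filter.inter_mem hU (Ioo_mem_nhds hx.1 hx.2))
      have hV0 : 0 < volume V := hV.measure_pos volume ⟨x, hxV⟩
      have hVI : V ∩ Ico a b = V :=
        inter_eq_left.2 fun y hy => Ioo_subset_Ico_self (hVU hy).2
      have := hab V hV.measurableSet
      rw [hVI] at this
      exact (ENNReal.mul_pos hc hV0.ne').trans_le
        (this.trans (measure_mono fun y hy => (hVU hy).1))
    have hsub : Ioo a₁ b₁ ∪ Ioo a₂ b₂ ∪ Ioo a₃ b₃ ⊆ msupp μ := by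
      rintro x ((hx | hx) | hx)
      · exact hmem hx fun s hs => le_trans (by gcongr; rw [add_assoc]; exact le_self_add) (hge s hs)
      · exact hmem hx fun s hs => le_trans
          (by gcongr; exact le_add_right le_add_self) (hge s hs)
      · exact hmem hx fun s hs => le_trans (by gcongr; exact le_add_self) (hge s hs)
    refine le_trans (le_of_eq ?_) (measure_mono hsub)
    rw [measure_union (disjoint_union_left.2 ⟨h₁₃, h₂₃⟩) measurableSet_Ioo,
      measure_union h₁₂ measurableSet_Ioo]
    simp

lemma volume_msupp_withDensity_rhoQmn (p k : ℕ) (hk : k + 1 ≤ p) (m n : ℤ) :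
    volume (msupp (volume.withDensity fun t => ENNReal.ofReal (rhoQmn p (k + 1) m n t)))
      = ENNReal.ofReal (1 + (k : ℝ) / p) := by
  have hp : (0 : ℝ) < p := by exact_mod_cast (by omega : 0 < p)
  have hkp : (k : ℝ) / p ≤ 1 := by
    rw [div_le_one hp]; exact_mod_cast (by omega : k ≤ p)
  have hind {s : Set ℝ} (hs : MeasurableSet s) (u : Set ℝ) :
      ∫⁻ t in u, s.indicator 1 t = volume (s ∩ u) := by
    rw [lintegral_indicator_one hs, Measure.restrict_apply hs]
  have hind' {s : Set ℝ} (hs : MeasurableSet s) (ν : Measure ℝ) :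
      ∫⁻ t, s.indicator 1 t ∂ν = ν s := lintegral_indicator_one hs
  have hsep : k = 0 ∨ m = n ∨ (n : ℝ) * (k + 1) + 1 ≤ m * (k + 1) ∨
      (m : ℝ) * (k + 1) + 2 ≤ n * (k + 1) := by
    rcases Nat.eq_zero_or_pos k with h0 | h0
    · exact .inl h0
    have hk1 : (1 : ℝ) ≤ k := by exact_mod_cast h0
    rcases lt_trichotomy m n with h | h | h
    · have : (m : ℝ) + 1 ≤ n := by exact_mod_cast h
      exact .inr (.inr (.inr (by nlinarith)))
    · exact .inr (.inl h)
    · have : (n : ℝ) + 1 ≤ m := by exact_mod_cast h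
      exact .inr (.inr (.inl (by nlinarith)))
  rw [volume_msupp_of_le (c := ((k : ENNReal) + 1)⁻¹)
    (a₁ := (m : ℝ) * (k + 1)) (b₁ := (m : ℝ) * (k + 1) + (k : ℝ) / p)
    (a₂ := (m : ℝ) * (k + 1) + 1) (b₂ := (m : ℝ) * (k + 1) + 1 + (k : ℝ) / p)
    (a₃ := (n : ℝ) * (k + 1) + (k : ℝ) / p) (b₃ := (n : ℝ) * (k + 1) + 1)]
  · have hk0 : 0 ≤ (k : ℝ) / p := by positivity
    rw [← ENNReal.ofReal_add (by linarith) (by linarith),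
      ← ENNReal.ofReal_add (by linarith) (by linarith)]
    congr 1
    ring
  · simp
  · rw [Set.disjoint_left]
    rintro x ⟨_, h1⟩ ⟨h2, _⟩
    linarith
  · rw [Set.disjoint_left]
    rintro x ⟨h1, h2⟩ ⟨h3, h4⟩
    rcases hsep with rfl | rfl | h | h
    · simp at h1 h2; linarith
    all_goals linarith
  · rw [Set.disjoint_left]
    rintro x ⟨h1, h2⟩ ⟨h3, h4⟩
    rcases hsep with rfl | rfl | h | h
    · simp at h1 h2; linarith
    all_goals linarith
  · intro s hs
    simpa only [hind hs, hind' hs] using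
      lintegral_withDensity_rhoQmn_le p k hk m n (measurable_one.indicator hs)
  · intro s hs
    simpa only [hind hs, hind' hs] using
      le_lintegral_withDensity_rhoQmn p k hk m n (measurable_one.indicator hs)

theorem stmt_18 (α : ℝ) (p q : ℕ) (hp : 0 < p) (hq : 0 < q) (hcop : Nat.Coprime p q)
    (β : ℝ) (hβdef : β = (p : ℝ) / q) (hβ : 1 ≤ β) (m n : ℤ)
    (μ : Measure ℝ)
    (hμ : μ = volume.withDensity (fun t => ENNReal.ofReal (rhoQmn p q m n t))) :
    IsProbabilityMeasure μ ∧ IsCIUPM (T α β) μ ∧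
      volume (msupp μ) = ENNReal.ofReal (1 + 1 / β - 1 / p) := by
  obtain ⟨k, rfl⟩ : ∃ k, q = k + 1 := ⟨q - 1, by omega⟩
  have hp' : (0 : ℝ) < p := by exact_mod_cast hp
  have hk : k + 1 ≤ p := by
    rw [hβdef, one_le_div (by positivity)] at hβ
    exact_mod_cast hβ
  rw [Nat.cast_succ] at hβdef
  subst hμ hβdef
  have hC := isCIUPM_withDensity_rhoQmn p k hk m n α
  refine ⟨hC.isProbabilityMeasure, hC, ?_⟩
  rw [volume_msupp_withDensity_rhoQmn p k hk m n]
  congr 1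
  field_simp
  ring
end
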